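/- Let (D, ω) be a good weighted oriented graph and let L be a good weighted median order of (D, ω) with feed vertex f. Then for every x ∈ J(f), ω(N⁺(x)\J(f)) ≤ ω(G_L\J(f)). Consequently, if x ∈ J(f) has the weighted SNP in the induced weighted subdigraph (D[J(f)], ω), then x has the weighted SNP in D. -/

import Mathlib

variable {V : Type*}

/-- Out-neighborhood of `v`. -/
def Nplus (E : V → V → Prop) (v : V) : Set V := {w | E v w}

/-- In-neighborhood of `v`. -/
def Nminus (E : V → V → Prop) (v : V) : Set V := {w | E w v}

/-- Second out-neighborhood: vertices at directed distance exactly 2 from `v`. -/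
def Npp (E : V → V → Prop) (v : V) : Set V :=
  {w | w ≠ v ∧ ¬ E v w ∧ ∃ u, E v u ∧ E u w}

/-- Weight of a set of vertices. -/
noncomputable def wt (ω : V → ℝ) (S : Set V) : ℝ := ∑ᶠ x ∈ S, ω x

/-- Total weight of the forward arcs of the ordering `L`. -/
noncomputable def fwdW {n : ℕ} (E : V → V → Prop) (ω : V → ℝ) (L : Fin n ≃ V) : ℝ :=
  ∑ᶠ p ∈ {p : Fin n × Fin n | p.1 < p.2 ∧ E (L p.1) (L p.2)}, ω (L p.1) * ω (L p.2)

/-- `L` is a weighted median order of `(E, ω)`. -/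
def IsWMedian {n : ℕ} (E : V → V → Prop) (ω : V → ℝ) (L : Fin n ≃ V) : Prop :=
  ∀ L' : Fin n ≃ V, fwdW E ω L' ≤ fwdW E ω L

/-- Number of forward arcs of the ordering `L`. -/
noncomputable def fwdCount {n : ℕ} (E : V → V → Prop) (L : Fin n ≃ V) : ℕ :=
  Set.ncard {p : Fin n × Fin n | p.1 < p.2 ∧ E (L p.1) (L p.2)}

/-- `L` is a (unweighted) median order of `E`. -/
def IsMedian {n : ℕ} (E : V → V → Prop) (L : Fin n ≃ V) : Prop :=
  ∀ L' : Fin n ≃ V, fwdCount E L' ≤ fwdCount E L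

/-- `K` is an interval of the digraph `E`. -/
def IsInterval (E : V → V → Prop) (K : Set V) : Prop :=
  ∀ u ∈ K, ∀ v ∈ K,
    Nplus E u \ K = Nplus E v \ K ∧ Nminus E u \ K = Nminus E v \ K

/-- `K` occurs as a set of consecutive vertices of the ordering `L`. -/
def OrderConvex {n : ℕ} (L : Fin n ≃ V) (K : Set V) : Prop :=
  ∀ i j k : Fin n, i ≤ j → j ≤ k → L i ∈ K → L k ∈ K → L j ∈ K

/-- `{x, y}` is a missing edge. -/
def IsMissing (E : V → V → Prop) (x y : V) : Prop := x ≠ y ∧ ¬ E x y ∧ ¬ E y x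

/-- The unordered pair `e` is a missing edge. -/
def IsMissingS (E : V → V → Prop) (e : Sym2 V) : Prop :=
  ∃ x y, e = s(x, y) ∧ IsMissing E x y

/-- The labelled losing relation: the missing edge `x₁y₁` loses to the missing edge `x₂y₂`
with this labelling of the endpoints. -/
def LosesLab (E : V → V → Prop) (x1 y1 x2 y2 : V) : Prop :=
  IsMissing E x1 y1 ∧ IsMissing E x2 y2 ∧
  E x1 x2 ∧ y2 ∉ Nplus E x1 ∪ Npp E x1 ∧ E y1 y2 ∧ x2 ∉ Nplus E y1 ∪ Npp E y1

/-- The losing relation on missing edges: the arcs of the dependency digraph `Δ`. -/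
def Loses (E : V → V → Prop) (e f : Sym2 V) : Prop :=
  ∃ x1 y1 x2 y2, e = s(x1, y1) ∧ f = s(x2, y2) ∧ LosesLab E x1 y1 x2 y2

/-- One merging step used to generate the sets `K(ξ)`. -/
def MissTouch (E : V → V → Prop) (u v : V) : Prop :=
  IsMissing E u v ∨ ∃ e f : Sym2 V, Loses E e f ∧ u ∈ e ∧ v ∈ f

/-- `u` and `v` lie in the same set `K(ξ)` (or `u = v`). -/
def SameK (E : V → V → Prop) : V → V → Prop := Relation.EqvGen (MissTouch E)

/-- `J(f)`: equal to `{f}` when `f` is whole, and to `K(ξ)` for the unique connected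
component `ξ` of the interval graph with `f ∈ K(ξ)` otherwise. -/
def Jset (E : V → V → Prop) (f : V) : Set V := {v | SameK E f v}

/-- A good digraph: all sets `K(ξ)` are intervals. -/
def GoodDigraph (E : V → V → Prop) : Prop := ∀ f : V, IsInterval E (Jset E f)

/-- The set `G_L` of good vertices of the ordering `L`. -/
def GoodSet {n : ℕ} (E : V → V → Prop) (L : Fin (n + 1) ≃ V) : Set V :=
  {w | w ∉ Nplus E (L (Fin.last n)) ∧
    ∃ i j : Fin (n + 1), i ≤ j ∧ w = L j ∧ E (L (Fin.last n)) (L i) ∧ E (L i) w}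

/-- The subdigraph of `E` induced on `K`. -/
def ERestrict (E : V → V → Prop) (K : Set V) : V → V → Prop :=
  fun x y => x ∈ K ∧ y ∈ K ∧ E x y

/-- `(a, b)` is a convenient orientation of the missing edge `ab`. -/
def ConvenientFor (E : V → V → Prop) (a b : V) : Prop :=
  ∀ v, v ≠ a → v ≠ b → E v a → b ∈ Nplus E v ∪ Npp E v

/-- Two missing edges lie in the same connected component of the dependency digraph. -/
def DeltaConn (E : V → V → Prop) : Sym2 V → Sym2 V → Prop :=
  Relation.ReflTransGen (fun e f => Loses E e f ∨ Loses E f e)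

/-- The connected component of `e` in the dependency digraph is a (maximal directed) path,
i.e. it contains a missing edge of in-degree zero. -/
def InPathComp (E : V → V → Prop) (e : Sym2 V) : Prop :=
  ∃ f, IsMissingS E f ∧ DeltaConn E e f ∧ ¬ ∃ g, Loses E g f

open Classical in
theorem wt_eq {V : Type*} [Fintype V] (ω : V → ℝ) (S : Set V) :
    wt ω S = ∑ x, if x ∈ S then ω x else 0 := by
  unfold wt
  rw [finsum_mem_def, finsum_eq_sum_of_fintype]
  simp only [Set.indicator_apply]

theorem wt_mono {V : Type*} [Fintype V] (ω : V → ℝ) (hω : ∀ v, 0 < ω v) {S T : Set V}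
    (h : S ⊆ T) : wt ω S ≤ wt ω T := by
  classical
  rw [wt_eq, wt_eq]
  refine Finset.sum_le_sum fun x _ => ?_
  by_cases hS : x ∈ S
  · simp [hS, h hS]
  · simp only [hS, if_false]
    split_ifs
    · exact (hω x).le
    · exact le_rfl

theorem wt_union {V : Type*} [Fintype V] (ω : V → ℝ) {S T : Set V}
    (h : Disjoint S T) : wt ω (S ∪ T) = wt ω S + wt ω T :=
  finsum_mem_union h (Set.toFinite _) (Set.toFinite _)

open Classical in
theorem fwdW_eq {V : Type*} {n : ℕ} (E : V → V → Prop) (ω : V → ℝ) (L : Fin n ≃ V) :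
    fwdW E ω L = ∑ p, ∑ q, if p < q ∧ E (L p) (L q) then ω (L p) * ω (L q) else 0 := by
  unfold fwdW
  rw [finsum_mem_def, finsum_eq_sum_of_fintype, Fintype.sum_prod_type]
  simp only [Set.indicator_apply, Set.mem_ofPred_eq]

/-- The vertices with positions in `[l, i)`. -/
def segm {V : Type*} {n : ℕ} (L : Fin n ≃ V) (l i : ℕ) : Set V :=
  {v | l ≤ (L.symm v : ℕ) ∧ (L.symm v : ℕ) < i}

theorem cyc_val {n : ℕ} (l i k : Fin (n + 1)) (h : l ≤ i) :
    ((Fin.cycleIcc l i k : Fin (n + 1)) : ℕ) =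
      if k < l then (k : ℕ) else if k < i then (k : ℕ) + 1 else if k = i then (l : ℕ) else k := by
  split_ifs with h1 h2 h3
  · rw [Fin.cycleIcc_of_lt h1]
  · rw [Fin.cycleIcc_of_ge_of_lt (not_lt.mp h1) h2]
    have : (k : ℕ) < n := lt_of_lt_of_le h2 (Nat.lt_succ_iff.mp i.2)
    exact Fin.val_add_one_of_lt (Fin.lt_def.mpr (by simpa using this))
  · subst h3
    rw [Fin.cycleIcc_of_last h]
  · rw [Fin.cycleIcc_of_gt (lt_of_le_of_ne (not_lt.mp h2) (Ne.symm h3))]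

theorem feedback {V : Type*} [Fintype V] {n : ℕ}
    (E : V → V → Prop) (hloop : ∀ v, ¬ E v v)
    (ω : V → ℝ) (hω : ∀ v, 0 < ω v)
    (L : Fin (n + 1) ≃ V) (hL : IsWMedian E ω L) (l i : Fin (n + 1)) (hli : l ≤ i) :
    wt ω (Nplus E (L i) ∩ segm L l i) ≤ wt ω (Nminus E (L i) ∩ segm L l i) := by
  classical
  set τ := Fin.cycleIcc l i with hτ
  have h := hL (τ.symm.trans L)
  rw [fwdW_eq, fwdW_eq, ← Equiv.sum_comp τ] at h
  have h2 : ∀ p, ∑ q, (if τ p < q ∧ E ((τ.symm.trans L) (τ p)) ((τ.symm.trans L) q) then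
      ω ((τ.symm.trans L) (τ p)) * ω ((τ.symm.trans L) q) else 0) =
      ∑ q, (if τ p < τ q ∧ E (L p) (L q) then ω (L p) * ω (L q) else 0) := by
    intro p
    rw [← Equiv.sum_comp τ]
    simp
  simp only [h2] at h
  have key : ∀ p q, (if τ p < τ q ∧ E (L p) (L q) then ω (L p) * ω (L q) else 0) =
      (if p < q ∧ E (L p) (L q) then ω (L p) * ω (L q) else 0) +
      (if p = i then (if L q ∈ Nplus E (L i) ∩ segm L l i then ω (L i) * ω (L q) else 0) else 0) -
      (if q = i then (if L p ∈ Nminus E (L i) ∩ segm L l i then ω (L i) * ω (L p) else 0)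
        else 0) := by
    intro p q
    have hpq : τ p < τ q ↔ (p ≠ i ∧ q ≠ i ∧ p < q) ∨ (p = i ∧ q ≠ i ∧ l ≤ q) ∨
        (q = i ∧ p < l) := by
      rw [Fin.lt_def, hτ, cyc_val l i p hli, cyc_val l i q hli]
      simp only [Fin.lt_def, Fin.le_def, Fin.ext_iff, ne_eq] at *
      split_ifs <;> omega
    simp only [hpq]
    simp only [Set.mem_inter_iff, Nplus, Nminus, segm, Set.mem_ofPred_eq, Equiv.symm_apply_apply]
    by_cases hp : p = i
    · subst hp
      by_cases hq : q = p
      · subst hq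
        simp [hloop]
      · by_cases hE : E (L p) (L q)
        · rcases lt_trichotomy q p with h1 | h1 | h1
          · simp [h1, h1.le, h1.not_gt, hE, hq]
          · exact absurd h1 hq
          · have : l ≤ q := hli.trans h1.le
            simp [h1, h1.le, h1.not_gt, hE, hq, this]
        · simp [hE, hq]
    · by_cases hq : q = i
      · subst hq
        by_cases hE : E (L p) (L q)
        · by_cases h1 : p < l
          · have : p < q := h1.trans_le hli
            simp [h1, hE, hp, this, h1.not_ge]
          · have h1' : l ≤ p := not_lt.mp h1
            by_cases h3 : p < q
            · simp [h1, hE, hp, h3, h1', mul_comm]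
            · simp [h1, hE, hp, h3]
        · simp [hE, hp]
      · simp [hp, hq]
  simp only [key, Finset.sum_sub_distrib, Finset.sum_add_distrib] at h
  have e1 : ∑ p, ∑ q, (if p = i then (if L q ∈ Nplus E (L i) ∩ segm L l i then
      ω (L i) * ω (L q) else 0) else 0) = ω (L i) * wt ω (Nplus E (L i) ∩ segm L l i) := by
    rw [Finset.sum_comm, wt_eq, ← Equiv.sum_comp L, Finset.mul_sum]
    simp only [Finset.sum_ite_eq', Finset.mem_univ, if_true, mul_ite, mul_zero]
  have e2 : ∑ p, ∑ q, (if q = i then (if L p ∈ Nminus E (L i) ∩ segm L l i then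
      ω (L i) * ω (L p) else 0) else 0) = ω (L i) * wt ω (Nminus E (L i) ∩ segm L l i) := by
    rw [wt_eq, ← Equiv.sum_comp L, Finset.mul_sum]
    simp only [Finset.sum_ite_eq', Finset.mem_univ, if_true, mul_ite, mul_zero]
  rw [e1, e2] at h
  exact le_of_mul_le_mul_left (by linarith) (hω (L i))

theorem mem_Jset_self {V : Type*} (E : V → V → Prop) (v : V) : v ∈ Jset E v :=
  Relation.EqvGen.refl v

theorem Jset_symm {V : Type*} {E : V → V → Prop} {u v : V} (h : u ∈ Jset E v) : v ∈ Jset E u :=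
  Relation.EqvGen.symm _ _ h

theorem adj_of_not {V : Type*} {E : V → V → Prop} {u v : V} (h : v ∉ Jset E u) :
    E u v ∨ E v u := by
  by_contra hc
  push Not at hc
  refine h (Relation.EqvGen.rel _ _ (Or.inl ⟨?_, hc.1, hc.2⟩))
  rintro rfl
  exact h (mem_Jset_self E u)

theorem int_out {V : Type*} {E : V → V → Prop} (hgood : GoodDigraph E) {c u v w : V}
    (hu : u ∈ Jset E c) (hv : v ∈ Jset E c) (hw : w ∉ Jset E c) (h : E u w) : E v w := by
  have := (hgood c u hu v hv).1
  have h1 : w ∈ Nplus E u \ Jset E c := ⟨h, hw⟩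
  rw [this] at h1
  exact h1.1

theorem int_in {V : Type*} {E : V → V → Prop} (hgood : GoodDigraph E) {c u v w : V}
    (hu : u ∈ Jset E c) (hv : v ∈ Jset E c) (hw : w ∉ Jset E c) (h : E w u) : E w v := by
  have := (hgood c u hu v hv).2
  have h1 : w ∈ Nminus E u \ Jset E c := ⟨h, hw⟩
  rw [this] at h1
  exact h1.1

/-- Segment argument, for segments starting at `l` and ending just before the last block. -/
theorem seg_ineq {V : Type*} [Fintype V] {n : ℕ}
    (E : V → V → Prop) (hloop : ∀ v, ¬ E v v) (hdigon : ∀ x y, ¬ (E x y ∧ E y x))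
    (ω : V → ℝ) (hω : ∀ v, 0 < ω v)
    (hgood : GoodDigraph E)
    (L : Fin (n + 1) ≃ V) (hL : IsWMedian E ω L)
    (f : V) (hf : f = L (Fin.last n)) (m : Fin (n + 1)) (hmJ : L m ∈ Jset E f)
    (hm : ∀ j, j < m → L j ∉ Jset E f) :
    ∀ d l : ℕ, l + d = m →
      wt ω (Nplus E f ∩ segm L l m) ≤ wt ω (GoodSet E L ∩ segm L l m) := by
  classical
  intro d
  induction d using Nat.strong_induction_on with
  | _ d ih =>
  intro l hl
  -- the bad vertices
  let Bad : Fin (n + 1) → Prop := fun i => ¬ E f (L i) ∧ L i ∉ GoodSet E L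
  have hex : ∃ i : ℕ, l ≤ i ∧ (i = m ∨ ∃ h : i < n + 1, i < m ∧ Bad ⟨i, h⟩) :=
    ⟨m, by omega, Or.inl rfl⟩
  obtain ⟨hli, hi⟩ := Nat.find_spec hex
  have hmin := fun j => Nat.find_min hex (m := j)
  set i := Nat.find hex with hidef
  clear_value i
  have him : i ≤ m := by
    rcases hi with h | ⟨_, h, _⟩ <;> omega
  have hin : i < n + 1 := lt_of_le_of_lt him m.2
  have hlin : l < n + 1 := by omega
  -- nothing in `[l, i)` is bad
  have hnb : ∀ j : Fin (n + 1), l ≤ j → (j : ℕ) < i → ¬ E f (L j) → L j ∈ GoodSet E L := by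
    intro j h1 h2 h3
    by_contra h4
    exact hmin j h2 ⟨h1, Or.inr ⟨j.2, by omega, h3, h4⟩⟩
  -- nothing in `[l, i)` lies in the block of `L i`
  have hnJ : ∀ j : Fin (n + 1), l ≤ j → (j : ℕ) < i → L j ∉ Jset E (L ⟨i, hin⟩) := by
    intro j h1 h2 hJ
    have hjf : L j ∉ Jset E f := hm j (by rw [Fin.lt_def]; omega)
    rcases hi with hi | ⟨hi1, hi2, hi3⟩
    · have : (⟨i, hin⟩ : Fin (n + 1)) = m := Fin.ext hi
      rw [this] at hJ
      exact hjf (Relation.EqvGen.trans _ _ _ hmJ hJ)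
    · have hif : L ⟨i, hin⟩ ∉ Jset E f := hm _ (by rw [Fin.lt_def]; exact hi2)
      have hfi : f ∉ Jset E (L ⟨i, hin⟩) := fun h => hif (Jset_symm h)
      have hEf : ¬ E f (L j) := fun h =>
        hi3.1 (int_in hgood hJ (mem_Jset_self E _) hfi h)
      obtain ⟨-, k, j', hk, hj', hfk, hkj⟩ := hnb j h1 h2 hEf
      have hjj : j = j' := L.injective hj'
      subst hjj
      rw [← hf] at hfk
      have hkJ : L k ∉ Jset E (L ⟨i, hin⟩) := fun h =>
        hi3.1 (int_in hgood h (mem_Jset_self E _) hfi hfk)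
      refine hi3.2 ⟨by rw [← hf]; exact hi3.1, k, ⟨i, hin⟩, ?_, rfl, by rw [← hf]; exact hfk,
        int_in hgood hJ (mem_Jset_self E _) hkJ hkj⟩
      rw [Fin.le_def] at *
      simp only
      omega
  have hseg1 : wt ω (Nplus E f ∩ segm L l i) ≤ wt ω (GoodSet E L ∩ segm L l i) := by
    refine le_trans (wt_mono ω hω (T := Nplus E (L ⟨i, hin⟩) ∩ segm L l i) ?_)
      (le_trans (feedback E hloop ω hω L hL ⟨l, hlin⟩ ⟨i, hin⟩ hli)
        (wt_mono ω hω (T := GoodSet E L ∩ segm L l i) ?_))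
    · rintro v ⟨hv, hvs⟩
      refine ⟨?_, hvs⟩
      obtain ⟨j, rfl⟩ := L.surjective v
      obtain ⟨h1, h2⟩ := hvs
      rw [Equiv.symm_apply_apply] at h1 h2
      have hv' : E f (L j) := hv
      show E (L ⟨i, hin⟩) (L j)
      have hnj := hnJ j h1 h2
      rcases hi with hi | ⟨hi1, hi2, hi3⟩
      · have : (⟨i, hin⟩ : Fin (n + 1)) = m := Fin.ext hi
        rw [this]
        exact int_out hgood (mem_Jset_self E f) hmJ (hm j (by rw [Fin.lt_def]; omega)) hv'
      · rcases adj_of_not hnj with h | h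
        · exact h
        · exfalso
          exact hi3.2 ⟨by rw [← hf]; exact hi3.1, j, ⟨i, hin⟩, by rw [Fin.le_def]; exact h2.le,
            rfl, by rw [← hf]; exact hv', h⟩
    · rintro v ⟨hv, hvs⟩
      refine ⟨?_, hvs⟩
      obtain ⟨j, rfl⟩ := L.surjective v
      obtain ⟨h1, h2⟩ := hvs
      rw [Equiv.symm_apply_apply] at h1 h2
      have hv' : E (L j) (L ⟨i, hin⟩) := hv
      refine hnb j h1 h2 fun hfj => ?_
      rcases hi with hi | ⟨hi1, hi2, hi3⟩
      · have : (⟨i, hin⟩ : Fin (n + 1)) = m := Fin.ext hi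
        rw [this] at hv'
        exact hdigon _ _ ⟨hfj, int_in hgood hmJ (mem_Jset_self E f)
          (hm j (by rw [Fin.lt_def]; omega)) hv'⟩
      · exact hi3.2 ⟨by rw [← hf]; exact hi3.1, j, ⟨i, hin⟩, by rw [Fin.le_def]; exact h2.le,
            rfl, by rw [← hf]; exact hfj, hv'⟩
  rcases hi with hi | ⟨hi1, hi2, hi3⟩
  · rw [← hi]
    exact hseg1
  · have hrest := ih (m - (i + 1)) (by omega) (i + 1) (by omega)
    have hdisj : Disjoint (segm L l i) (segm L (i + 1) m) := by
      rw [Set.disjoint_left]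
      rintro v ⟨h1, h2⟩ ⟨h3, h4⟩
      omega
    have hd : ∀ S : Set V, Disjoint (S ∩ segm L l i) (S ∩ segm L (i + 1) m) := fun S =>
      hdisj.mono Set.inter_subset_right Set.inter_subset_right
    have hA : Nplus E f ∩ segm L l m ⊆
        (Nplus E f ∩ segm L l i) ∪ (Nplus E f ∩ segm L (i + 1) m) := by
      rintro v ⟨hv, h1, h2⟩
      rcases lt_trichotomy (L.symm v : ℕ) i with h | h | h
      · exact Or.inl ⟨hv, h1, h⟩
      · exfalso
        apply hi3.1
        have : (⟨i, hi1⟩ : Fin (n + 1)) = L.symm v := Fin.ext h.symm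
        rw [this, Equiv.apply_symm_apply]
        exact hv
      · exact Or.inr ⟨hv, h, h2⟩
    have hB : (GoodSet E L ∩ segm L l i) ∪ (GoodSet E L ∩ segm L (i + 1) m) ⊆
        GoodSet E L ∩ segm L l m := by
      rintro v (⟨hv, h1, h2⟩ | ⟨hv, h1, h2⟩)
      · exact ⟨hv, h1, by omega⟩
      · exact ⟨hv, by omega, h2⟩
    have h1 := wt_mono ω hω hA
    have h2 := wt_mono ω hω hB
    rw [wt_union ω (hd _)] at h1 h2
    linarith

theorem stmt_3 {V : Type*} [Fintype V] {n : ℕ}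
    (E : V → V → Prop) (hloop : ∀ v, ¬ E v v) (hdigon : ∀ x y, ¬ (E x y ∧ E y x))
    (ω : V → ℝ) (hω : ∀ v, 0 < ω v)
    (hgood : GoodDigraph E)
    (L : Fin (n + 1) ≃ V) (hL : IsWMedian E ω L)
    (hLgood : ∀ v, OrderConvex L (Jset E v))
    (f : V) (hf : f = L (Fin.last n)) :
    ∀ x ∈ Jset E f,
      wt ω (Nplus E x \ Jset E f) ≤ wt ω (GoodSet E L \ Jset E f) ∧
      (wt ω (Nplus (ERestrict E (Jset E f)) x) ≤ wt ω (Npp (ERestrict E (Jset E f)) x) →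
        wt ω (Nplus E x) ≤ wt ω (Npp E x)) := by
  have hfJ : L (Fin.last n) ∈ Jset E f := hf ▸ mem_Jset_self E f
  have main : wt ω (Nplus E f \ Jset E f) ≤ wt ω (GoodSet E L \ Jset E f) := by
    classical
    have hex : ∃ i : ℕ, ∃ h : i < n + 1, L ⟨i, h⟩ ∈ Jset E f := ⟨n, Nat.lt_succ_self n, hfJ⟩
    obtain ⟨m, ⟨hm1, hm2⟩, hmin⟩ : ∃ m : ℕ, (∃ h : m < n + 1, L ⟨m, h⟩ ∈ Jset E f) ∧
        ∀ j : ℕ, j < m → ¬ ∃ h : j < n + 1, L ⟨j, h⟩ ∈ Jset E f :=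
      ⟨Nat.find hex, Nat.find_spec hex, fun j => Nat.find_min hex (m := j)⟩
    have hJ : (Jset E f)ᶜ = segm L 0 m := by
      ext v
      obtain ⟨j, rfl⟩ := L.surjective v
      simp only [segm, Set.mem_compl_iff, Set.mem_ofPred_eq, Equiv.symm_apply_apply, Nat.zero_le,
        true_and]
      constructor
      · intro h
        by_contra hc
        exact h (hLgood f ⟨m, hm1⟩ j (Fin.last n) (not_lt.mp hc) (Fin.le_last j) hm2 hfJ)
      · intro h hj
        exact hmin j h ⟨j.2, hj⟩
    rw [Set.sdiff_eq, Set.sdiff_eq, hJ]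
    exact seg_ineq E hloop hdigon ω hω hgood L hL f hf ⟨m, hm1⟩ hm2
      (fun j hj hjJ => hmin j hj ⟨j.2, hjJ⟩) m 0 (by simp)
  intro x hx
  have hxf : Nplus E x \ Jset E f = Nplus E f \ Jset E f :=
    (hgood f x hx f (mem_Jset_self E f)).1
  have first : wt ω (Nplus E x \ Jset E f) ≤ wt ω (GoodSet E L \ Jset E f) := by
    rw [hxf]
    exact main
  refine ⟨first, fun hs => ?_⟩
  have hA : Nplus E x ⊆ Nplus (ERestrict E (Jset E f)) x ∪ (Nplus E x \ Jset E f) := by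
    intro v hv
    by_cases h : v ∈ Jset E f
    · exact Or.inl ⟨hx, h, hv⟩
    · exact Or.inr ⟨hv, h⟩
  have hB : Npp (ERestrict E (Jset E f)) x ∪ (GoodSet E L \ Jset E f) ⊆ Npp E x := by
    rintro v (⟨h1, h2, u, h3, h4⟩ | ⟨⟨h1, i, j, hij, rfl, h2, h3⟩, h4⟩)
    · exact ⟨h1, fun h => h2 ⟨hx, h4.2.1, h⟩, u, h3.2.2, h4.2.2⟩
    · rw [← hf] at h1 h2
      refine ⟨fun h => h4 (h ▸ hx), fun h => h1 (int_out hgood hx (mem_Jset_self E f) h4 h),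
        L i, ?_, h3⟩
      have hi : L i ∉ Jset E f := fun h => h1 (int_out hgood h (mem_Jset_self E f) h4 h3)
      exact int_out hgood (mem_Jset_self E f) hx hi h2
  have hd1 : Disjoint (Nplus (ERestrict E (Jset E f)) x) (Nplus E x \ Jset E f) := by
    rw [Set.disjoint_left]
    exact fun v h1 h2 => h2.2 h1.2.1
  have hd2 : Disjoint (Npp (ERestrict E (Jset E f)) x) (GoodSet E L \ Jset E f) := by
    rw [Set.disjoint_left]
    rintro v ⟨_, _, u, _, h1⟩ h2
    exact h2.2 h1.2.1
  have h1 := wt_mono ω hω hA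
  have h2 := wt_mono ω hω hB
  rw [wt_union ω hd1] at h1
  rw [wt_union ω hd2] at h2
  linarith
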